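/- Fix ω₀ = 0 and ω₁ > 0, so ω(λ) = 2ω₁ sin(λ/2) on [0, 2π]. Let n ≥ 6 and let Q, P : ℝ → ℂ be n times continuously differentiable 2π-periodic functions, and define q_k(t) = (1/2π)·∫₀^{2π}( Q(λ)·cos(t·ω(λ)) + P(λ)·sin(t·ω(λ))/ω(λ) )·e^{−ikλ} dλ, where sin(tω)/ω is interpreted as t at points where ω(λ) = 0. Set C = Q(π)/√(π·ω₁) and S = P(π)/(2ω₁·√(π·ω₁)). Then for every fixed k ∈ ℤ: lim_{t→∞} [ √t·( q_k(t) − P(0)/(2ω₁) ) − (−1)^k·( C·cos(2ω₁t − π/4) + S·sin(2ω₁t − π/4) ) ] = 0. -/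

import Mathlib

open scoped Real
open MeasureTheory Complex Filter

theorem integral_exp_neg_mul_le_inv {c b : ℝ} (hc : 0 < c) :
    ∫ x in (0:ℝ)..b, Real.exp (-(c * x)) ≤ 1 / c := by
  have hd : ∀ x ∈ Set.uIcc 0 b,
      HasDerivAt (fun x => -(Real.exp (-(c * x)) / c)) (Real.exp (-(c * x))) x := by
    intro x _
    have h := ((((hasDerivAt_id x).const_mul c).neg.exp).div_const c).neg
    refine h.congr_deriv ?_
    simp only [id, Pi.neg_apply]
    field_simp
  rw [intervalIntegral.integral_eq_sub_of_hasDerivAt hd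
    ((by fun_prop : Continuous fun x => Real.exp (-(c * x))).intervalIntegrable _ _)]
  have : 0 < Real.exp (-(c * b)) / c := by positivity
  simp only [mul_zero, neg_zero, Real.exp_zero]
  linarith

theorem integral_sin_mul_exp_neg_mul (T s : ℝ) :
    ∫ u in (0:ℝ)..T, Real.sin u * Real.exp (-(u * s)) =
      1 / (1 + s ^ 2) - Real.exp (-(T * s)) * ((Real.cos T + s * Real.sin T) / (1 + s ^ 2)) := by
  have hs : 1 + s ^ 2 ≠ 0 := by positivity
  have hd : ∀ u ∈ Set.uIcc 0 T, HasDerivAt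
      (fun u => -(Real.exp (-(u * s)) * ((Real.cos u + s * Real.sin u) / (1 + s ^ 2))))
      (Real.sin u * Real.exp (-(u * s))) u := by
    intro u _
    have h := (((((hasDerivAt_id u).mul_const s).neg.exp)).mul
      (((Real.hasDerivAt_cos u).add ((Real.hasDerivAt_sin u).const_mul s)).div_const
        (1 + s ^ 2))).neg
    refine h.congr_deriv ?_
    simp only [id, Pi.neg_apply, Pi.add_apply]
    field_simp
    ring
  rw [intervalIntegral.integral_eq_sub_of_hasDerivAt hd
    ((by fun_prop : Continuous fun u => Real.sin u * Real.exp (-(u * s))).intervalIntegrable _ _)]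
  simp
  ring

theorem sin_mul_integral_exp_neg_mul (u N : ℝ) :
    ∫ s in (0:ℝ)..N, Real.sin u * Real.exp (-(u * s)) =
      Real.sinc u - Real.sinc u * Real.exp (-(u * N)) := by
  rcases eq_or_ne u 0 with rfl | hu
  · simp
  have hd : ∀ s ∈ Set.uIcc 0 N, HasDerivAt
      (fun s => -(Real.sinc u * Real.exp (-(u * s)))) (Real.sin u * Real.exp (-(u * s))) s := by
    intro s _
    have h := ((((hasDerivAt_id s).const_mul u).neg.exp).const_mul (Real.sinc u)).neg
    refine h.congr_deriv ?_
    rw [Real.sinc_of_ne_zero hu]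
    simp only [id, Pi.neg_apply]
    field_simp
  rw [intervalIntegral.integral_eq_sub_of_hasDerivAt hd
    ((by fun_prop : Continuous fun s => Real.sin u * Real.exp (-(u * s))).intervalIntegrable _ _)]
  simp
  ring

theorem abs_integral_sinc_sub_arctan_le {T N : ℝ} (hT : 0 < T) (hN : 0 < N) :
    |(∫ u in (0:ℝ)..T, Real.sinc u) - Real.arctan N| ≤ 1 / N + 2 / T := by
  have hsc := Real.continuous_sinc
  have hpos : ∀ s : ℝ, 1 + s ^ 2 ≠ 0 := fun s => by positivity
  have hswap : (∫ u in (0:ℝ)..T, ∫ s in (0:ℝ)..N, Real.sin u * Real.exp (-(u * s))) =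
      ∫ s in (0:ℝ)..N, ∫ u in (0:ℝ)..T, Real.sin u * Real.exp (-(u * s)) := by
    simp only [intervalIntegral.integral_of_le hT.le, intervalIntegral.integral_of_le hN.le]
    apply integral_integral_swap
    rw [Measure.prod_restrict]
    refine ((by fun_prop : Continuous fun p : ℝ × ℝ =>
      Real.sin p.1 * Real.exp (-(p.1 * p.2))).continuousOn.integrableOn_compact
        (isCompact_Icc.prod isCompact_Icc : IsCompact (Set.Icc 0 T ×ˢ Set.Icc 0 N))).mono_set
      (Set.prod_mono Set.Ioc_subset_Icc_self Set.Ioc_subset_Icc_self)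
  simp only [sin_mul_integral_exp_neg_mul, integral_sin_mul_exp_neg_mul] at hswap
  have hcR : Continuous fun s : ℝ =>
      Real.exp (-(T * s)) * ((Real.cos T + s * Real.sin T) / (1 + s ^ 2)) := by
    fun_prop (disch := exact hpos _)
  rw [intervalIntegral.integral_sub (hsc.intervalIntegrable _ _)
      ((by fun_prop : Continuous fun u =>
        Real.sinc u * Real.exp (-(u * N))).intervalIntegrable _ _),
    intervalIntegral.integral_sub
      ((by fun_prop (disch := exact hpos _) :
        Continuous fun s : ℝ => 1 / (1 + s ^ 2)).intervalIntegrable _ _)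
      (hcR.intervalIntegrable _ _), integral_one_div_one_add_sq, Real.arctan_zero, sub_zero]
    at hswap
  have h1 : ‖∫ u in (0:ℝ)..T, Real.sinc u * Real.exp (-(u * N))‖ ≤ 1 / N := by
    refine le_trans (intervalIntegral.norm_integral_le_of_norm_le hT.le
      (g := fun u => Real.exp (-(N * u))) (ae_of_all _ fun u _ => ?_)
      ((by fun_prop : Continuous fun u => Real.exp (-(N * u))).intervalIntegrable _ _))
      (integral_exp_neg_mul_le_inv hN)
    rw [norm_mul, Real.norm_eq_abs, Real.norm_eq_abs, Real.abs_exp, mul_comm u N]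
    exact mul_le_of_le_one_left (Real.exp_pos _).le (Real.abs_sinc_le_one u)
  have h2 : ‖∫ s in (0:ℝ)..N,
      Real.exp (-(T * s)) * ((Real.cos T + s * Real.sin T) / (1 + s ^ 2))‖ ≤ 2 / T := by
    refine le_trans (intervalIntegral.norm_integral_le_of_norm_le hN.le
      (g := fun s => 2 * Real.exp (-(T * s))) (ae_of_all _ fun s hs => ?_)
      ((by fun_prop : Continuous fun s => 2 * Real.exp (-(T * s))).intervalIntegrable _ _)) ?_
    · rw [norm_mul, Real.norm_eq_abs, Real.norm_eq_abs, Real.abs_exp, mul_comm]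
      refine mul_le_mul_of_nonneg_right ?_ (Real.exp_pos _).le
      have hp : 0 < 1 + s ^ 2 := by positivity
      rw [abs_div, abs_of_pos hp, div_le_iff₀ hp]
      calc |Real.cos T + s * Real.sin T| ≤ |Real.cos T| + |s * Real.sin T| := abs_add_le _ _
        _ ≤ 1 + s * 1 := by
          rw [abs_mul, abs_of_pos hs.1]
          have := hs.1.le
          gcongr
          · exact Real.abs_cos_le_one T
          · exact Real.abs_sin_le_one T
        _ ≤ 2 * (1 + s ^ 2) := by nlinarith [sq_nonneg (s - 1)]
    · rw [intervalIntegral.integral_const_mul]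
      have := integral_exp_neg_mul_le_inv (b := N) hT
      calc _ ≤ 2 * (1 / T) := by gcongr
        _ = 2 / T := by ring
  rw [Real.norm_eq_abs] at h1 h2
  rw [abs_le] at h1 h2 ⊢
  constructor <;> linarith [h1.1, h1.2, h2.1, h2.2]

theorem abs_integral_sinc_sub_pi_div_two_le {T : ℝ} (hT : 0 < T) :
    |(∫ u in (0:ℝ)..T, Real.sinc u) - π / 2| ≤ 2 / T := by
  have hl : Tendsto (fun N : ℝ => |(∫ u in (0:ℝ)..T, Real.sinc u) - Real.arctan N|) atTop
      (nhds |(∫ u in (0:ℝ)..T, Real.sinc u) - π / 2|) :=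
    (tendsto_const_nhds.sub (Real.tendsto_arctan_atTop.mono_right nhdsWithin_le_nhds)).abs
  have hr : Tendsto (fun N : ℝ => 1 / N + 2 / T) atTop (nhds (0 + 2 / T)) := by
    simpa using tendsto_inv_atTop_zero.add_const (2 / T)
  rw [zero_add] at hr
  exact le_of_tendsto_of_tendsto hl hr
    ((eventually_gt_atTop 0).mono fun N hN => abs_integral_sinc_sub_arctan_le hT hN)

theorem norm_integral_cexp_neg_mul_sq_le {b : ℂ} (hre : 0 ≤ b.re) (hb : 1 ≤ ‖b‖) {S T : ℝ}
    (hS : 0 < S) (hST : S ≤ T) :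
    ‖∫ w in S..T, cexp (-b * (w : ℂ) ^ 2)‖ ≤ 1 / S := by
  have hb0 : b ≠ 0 := by rintro rfl; simp at hb; linarith
  have hpos : ∀ w ∈ Set.uIcc S T, 0 < w := fun w hw => by
    rw [Set.uIcc_of_le hST] at hw; exact hS.trans_le hw.1
  have hexp : ∀ w : ℝ, ‖cexp (-b * (w : ℂ) ^ 2)‖ ≤ 1 := fun w => by
    rw [norm_exp, Real.exp_le_one_iff, ← ofReal_pow, re_mul_ofReal, neg_re]
    nlinarith [sq_nonneg w]
  have hu : ∀ w ∈ Set.uIcc S T, HasDerivAt (fun w : ℝ => -((w : ℂ)⁻¹ / (2 * b)))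
      (1 / (2 * b * (w : ℂ) ^ 2)) w := by
    intro w hw
    have hw0 : (w : ℂ) ≠ 0 := ofReal_ne_zero.2 (hpos w hw).ne'
    refine ((((hasDerivAt_id w).ofReal_comp.inv hw0).div_const (2 * b)).neg).congr_deriv ?_
    simp only [id, ofReal_one]
    field_simp
  have hv : ∀ w ∈ Set.uIcc S T, HasDerivAt (fun w : ℝ => cexp (-b * (w : ℂ) ^ 2))
      (-(2 * b * w) * cexp (-b * (w : ℂ) ^ 2)) w := by
    intro w _
    refine ((((hasDerivAt_id w).ofReal_comp.pow 2).const_mul (-b)).cexp).congr_deriv ?_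
    simp only [id, ofReal_one, Pi.pow_apply]
    push_cast
    ring
  have hu'c : ContinuousOn (fun w : ℝ => 1 / (2 * b * (w : ℂ) ^ 2)) (Set.uIcc S T) := by
    refine continuousOn_const.div (by fun_prop) fun w hw => ?_
    have hw0 : (w : ℂ) ≠ 0 := ofReal_ne_zero.2 (hpos w hw).ne'
    simp [hb0, hw0]
  have hparts := intervalIntegral.integral_mul_deriv_eq_deriv_mul hu hv hu'c.intervalIntegrable
    ((by fun_prop : Continuous fun w : ℝ =>
      -(2 * b * w) * cexp (-b * (w : ℂ) ^ 2)).intervalIntegrable _ _)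
  have hcongr : ∫ w in S..T, cexp (-b * (w : ℂ) ^ 2) =
      ∫ w in S..T, -((w : ℂ)⁻¹ / (2 * b)) * (-(2 * b * w) * cexp (-b * (w : ℂ) ^ 2)) := by
    refine intervalIntegral.integral_congr fun w hw => ?_
    have hw0 : (w : ℂ) ≠ 0 := ofReal_ne_zero.2 (hpos w hw).ne'
    field_simp
  have hbd : ∀ w : ℝ, 0 < w → ‖-((w : ℂ)⁻¹ / (2 * b)) * cexp (-b * (w : ℂ) ^ 2)‖ ≤ w⁻¹ / 2 := by
    intro w hw
    rw [norm_mul, norm_neg, norm_div, norm_inv, norm_mul, norm_real, Real.norm_of_nonneg hw.le]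
    calc _ ≤ w⁻¹ / (‖(2:ℂ)‖ * ‖b‖) * 1 := by gcongr; exact hexp w
      _ ≤ w⁻¹ / (2 * 1) * 1 := by
        rw [norm_ofNat]; gcongr
      _ = w⁻¹ / 2 := by ring
  have hd : ∀ w ∈ Set.uIcc S T, HasDerivAt (fun w : ℝ => -(w⁻¹ / 2)) (1 / (2 * w ^ 2)) w := by
    intro w hw
    refine (((hasDerivAt_id w).inv (hpos w hw).ne').div_const 2).neg.congr_deriv ?_
    simp only [id]
    field_simp
  have hint : ∫ w in S..T, 1 / (2 * w ^ 2) = S⁻¹ / 2 - T⁻¹ / 2 := by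
    rw [intervalIntegral.integral_eq_sub_of_hasDerivAt hd]
    · ring
    · exact (continuousOn_const.div (by fun_prop) fun w hw => by
        have := hpos w hw; positivity).intervalIntegrable
  have hrest : ‖∫ w in S..T, 1 / (2 * b * (w : ℂ) ^ 2) * cexp (-b * (w : ℂ) ^ 2)‖ ≤
      S⁻¹ / 2 - T⁻¹ / 2 := by
    rw [← hint]
    refine intervalIntegral.norm_integral_le_of_norm_le hST (ae_of_all _ fun w hw => ?_)
      (continuousOn_const.div (by fun_prop) fun w hw => by
        have := hpos w hw; positivity).intervalIntegrable
    have hw0 : 0 < w := hS.trans hw.1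
    rw [norm_mul, norm_div, norm_mul, norm_mul, norm_pow, norm_real, Real.norm_of_nonneg hw0.le,
      norm_one, norm_ofNat]
    calc _ ≤ 1 / (2 * ‖b‖ * w ^ 2) * 1 := by gcongr; exact hexp w
      _ ≤ 1 / (2 * 1 * w ^ 2) * 1 := by gcongr
      _ = 1 / (2 * w ^ 2) := by ring
  rw [hcongr, hparts]
  have h1 := hbd S hS
  have h2 := hbd T (hS.trans_le hST)
  calc _ ≤ _ := norm_sub_le _ _
    _ ≤ (T⁻¹ / 2 + S⁻¹ / 2) + (S⁻¹ / 2 - T⁻¹ / 2) :=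
      add_le_add ((norm_sub_le _ _).trans (add_le_add h2 h1)) hrest
    _ = 1 / S := by ring

theorem norm_integral_cexp_neg_mul_sq_sub_le {b : ℂ} (hre : 0 < b.re) (hb : 1 ≤ ‖b‖) {T : ℝ}
    (hT : 0 < T) :
    ‖(∫ w in (0:ℝ)..T, cexp (-b * (w : ℂ) ^ 2)) - (π / b) ^ (1 / 2 : ℂ) / 2‖ ≤ 1 / T := by
  have hcont : Continuous fun w : ℝ => cexp (-b * (w : ℂ) ^ 2) := by fun_prop
  have hl : Tendsto (fun R : ℝ => ‖(∫ w in (0:ℝ)..T, cexp (-b * (w : ℂ) ^ 2)) -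
      ∫ w in (0:ℝ)..R, cexp (-b * (w : ℂ) ^ 2)‖) atTop
      (nhds ‖(∫ w in (0:ℝ)..T, cexp (-b * (w : ℂ) ^ 2)) - (π / b) ^ (1 / 2 : ℂ) / 2‖) := by
    rw [← integral_gaussian_complex_Ioi hre]
    exact (tendsto_const_nhds.sub (intervalIntegral_tendsto_integral_Ioi 0
      (integrable_cexp_neg_mul_sq hre).integrableOn tendsto_id)).norm
  refine le_of_tendsto hl ((eventually_ge_atTop T).mono fun R hR => ?_)
  rw [norm_sub_rev, intervalIntegral.integral_interval_sub_left (hcont.intervalIntegrable _ _)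
    (hcont.intervalIntegrable _ _)]
  exact norm_integral_cexp_neg_mul_sq_le hre.le hb hT hR

theorem pi_div_I_cpow_half : ((π : ℂ) / I) ^ (1 / 2 : ℂ) = √π * cexp (-(π / 4 : ℝ) * I) := by
  have hsq : ((π : ℂ) / I) = (√π * cexp (-(π / 4 : ℝ) * I)) ^ 2 := by
    rw [mul_pow, ← ofReal_pow, Real.sq_sqrt Real.pi_pos.le, ← Complex.exp_nat_mul,
      show ((2 : ℕ) : ℂ) * (-(π / 4 : ℝ) * I) = -(π / 2 * I) by push_cast; ring,
      Complex.exp_neg, Complex.exp_pi_div_two_mul_I, div_eq_mul_inv]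
  rw [hsq, one_div, sq_cpow_two_inv]
  rw [re_ofReal_mul, ← ofReal_neg, exp_ofReal_mul_I_re, Real.cos_neg, Real.cos_pi_div_four]
  positivity

theorem norm_integral_cexp_neg_I_mul_sq_sub_le {T : ℝ} (hT : 0 < T) :
    ‖(∫ w in (0:ℝ)..T, cexp (-I * (w : ℂ) ^ 2)) - √π * cexp (-(π / 4 : ℝ) * I) / 2‖ ≤ 1 / T := by
  have hb : Tendsto (fun ε : ℝ => (ε : ℂ) + I) (nhdsWithin 0 (Set.Ioi 0)) (nhds I) := by
    have : Continuous fun ε : ℝ => (ε : ℂ) + I := by fun_prop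
    simpa using (this.tendsto 0).mono_left nhdsWithin_le_nhds
  have h1 : Tendsto (fun ε : ℝ => ∫ w in (0:ℝ)..T, cexp (-((ε : ℂ) + I) * (w : ℂ) ^ 2))
      (nhdsWithin 0 (Set.Ioi 0)) (nhds (∫ w in (0:ℝ)..T, cexp (-I * (w : ℂ) ^ 2))) := by
    have : Continuous fun ε : ℝ => ∫ w in (0:ℝ)..T, cexp (-((ε : ℂ) + I) * (w : ℂ) ^ 2) :=
      intervalIntegral.continuous_parametric_intervalIntegral_of_continuous' (by fun_prop) _ _
    simpa using (this.tendsto 0).mono_left nhdsWithin_le_nhds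
  have h2 : Tendsto (fun ε : ℝ => ((π : ℂ) / ((ε : ℂ) + I)) ^ (1 / 2 : ℂ) / 2)
      (nhdsWithin 0 (Set.Ioi 0)) (nhds (√π * cexp (-(π / 4 : ℝ) * I) / 2)) := by
    rw [← pi_div_I_cpow_half]
    refine ((tendsto_const_nhds.div hb I_ne_zero).cpow tendsto_const_nhds ?_).div_const 2
    rw [div_I]
    right
    simp [Real.pi_ne_zero]
  refine le_of_tendsto (h1.sub h2).norm (eventually_mem_nhdsWithin.mono fun ε hε => ?_)
  have hε : 0 < ε := hε
  refine norm_integral_cexp_neg_mul_sq_sub_le (by simpa using hε) ?_ hT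
  calc (1 : ℝ) = |((ε : ℂ) + I).im| := by simp
    _ ≤ _ := abs_im_le_norm _

theorem integral_cos_mul_cexp_I_mul_sin {ρ : ℝ} :
    ρ * ∫ l in (0:ℝ)..π, (Real.cos ((π - l) / 4) : ℂ) * cexp (I * (ρ ^ 2 * Real.sin (l / 2) : ℝ)) =
      2 * √2 * cexp (I * ρ ^ 2) * ∫ w in (0:ℝ)..ρ, cexp (-I * (w : ℂ) ^ 2) := by
  have hd : ∀ l ∈ Set.uIcc 0 π, HasDerivAt (fun l => ρ * √2 * Real.sin ((π - l) / 4))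
      (-(ρ * √2 / 4 * Real.cos ((π - l) / 4))) l := by
    intro l _
    refine (((((hasDerivAt_id l).const_sub π).div_const 4).sin).const_mul (ρ * √2)).congr_deriv ?_
    simp only [id]
    ring
  have h := intervalIntegral.integral_deriv_smul_comp (g := fun w : ℝ => cexp (-I * (w : ℂ) ^ 2))
    hd (by fun_prop) (by fun_prop)
  have hs : √2 * (√2 / 2) = 1 := by
    rw [← mul_div_assoc, Real.mul_self_sqrt (by norm_num)]; norm_num
  simp only [sub_zero, sub_self, zero_div, Real.sin_zero, mul_zero, Real.sin_pi_div_four,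
    mul_assoc ρ, hs, mul_one] at h
  rw [intervalIntegral.integral_symm 0 ρ, ← neg_eq_iff_eq_neg] at h
  rw [← h, ← intervalIntegral.integral_neg, ← intervalIntegral.integral_const_mul,
    ← intervalIntegral.integral_const_mul]
  refine intervalIntegral.integral_congr fun l _ => ?_
  have hsin : Real.sin (l / 2) = 1 - 2 * Real.sin ((π - l) / 4) ^ 2 := by
    rw [← Real.cos_pi_div_two_sub, show π / 2 - l / 2 = 2 * ((π - l) / 4) by ring,
      Real.cos_two_mul, Real.cos_sq']
    ring
  have hexp : cexp (I * (ρ ^ 2 * Real.sin (l / 2) : ℝ)) = cexp (I * ρ ^ 2) *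
      cexp (-I * ((ρ * (√2 * Real.sin ((π - l) / 4)) : ℝ) : ℂ) ^ 2) := by
    have h2 : (√2 : ℂ) ^ 2 = 2 := by rw [← ofReal_pow, Real.sq_sqrt (by norm_num)]; norm_num
    rw [← Complex.exp_add, hsin]
    congr 1
    push_cast
    linear_combination (I * ρ ^ 2 * (Complex.sin ((π - l) / 4)) ^ 2) * h2
  have h2 : (√2 : ℂ) * √2 = 2 := by rw [← ofReal_mul, Real.mul_self_sqrt (by norm_num)]; norm_num
  simp only [Function.comp, real_smul, hexp]
  push_cast
  linear_combination (-(ρ : ℂ) * Complex.cos ((π - l) / 4) * cexp (I * ρ ^ 2) *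
    cexp (-I * (ρ * (√2 * Complex.sin ((π - l) / 4))) ^ 2) / 2) * h2

/-- `D` is continuous on `[0, π]` and has a bounded derivative on `(0, π)`. -/
def HasBoundedDeriv (D : ℝ → ℂ) : Prop :=
  ContinuousOn D (Set.Icc 0 π) ∧
    ∃ (D' : ℝ → ℂ) (M : ℝ), ∀ x ∈ Set.Ioo 0 π, HasDerivAt D (D' x) x ∧ ‖D' x‖ ≤ M

theorem HasBoundedDeriv.add {D E : ℝ → ℂ} (hD : HasBoundedDeriv D) (hE : HasBoundedDeriv E) :
    HasBoundedDeriv fun x => D x + E x := by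
  obtain ⟨hDc, D', M, hD'⟩ := hD
  obtain ⟨hEc, E', M', hE'⟩ := hE
  exact ⟨hDc.add hEc, fun x => D' x + E' x, M + M', fun x hx =>
    ⟨(hD' x hx).1.add (hE' x hx).1, norm_add_le_of_le (hD' x hx).2 (hE' x hx).2⟩⟩

theorem HasBoundedDeriv.const_mul {D : ℝ → ℂ} (hD : HasBoundedDeriv D) (a : ℂ) :
    HasBoundedDeriv fun x => a * D x := by
  obtain ⟨hDc, D', M, hD'⟩ := hD
  refine ⟨continuousOn_const.mul hDc, fun x => a * D' x, ‖a‖ * M, fun x hx =>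
    ⟨(hD' x hx).1.const_mul a, ?_⟩⟩
  rw [norm_mul]
  exact mul_le_mul_of_nonneg_left (hD' x hx).2 (norm_nonneg a)

theorem hasBoundedDeriv_of_continuousOn {D D' : ℝ → ℂ}
    (hD : ∀ x ∈ Set.Icc 0 π, HasDerivAt D (D' x) x) (hD' : ContinuousOn D' (Set.Icc 0 π)) :
    HasBoundedDeriv D := by
  obtain ⟨M, hM⟩ := isCompact_Icc.exists_bound_of_continuousOn hD'
  exact ⟨fun x hx => (hD x hx).continuousAt.continuousWithinAt, D', M, fun x hx =>
    ⟨hD x (Set.Ioo_subset_Icc_self hx), hM x (Set.Ioo_subset_Icc_self hx)⟩⟩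

theorem HasBoundedDeriv.exists_norm_integral_le {D : ℝ → ℂ} (hD : HasBoundedDeriv D)
    {Φ K : ℝ → ℝ} (hΦ : ∀ u, HasDerivAt Φ (K u) u) (hK : Continuous K) (hΦ1 : ∀ u, |Φ u| ≤ 1) :
    ∃ C, ∀ τ : ℝ, 0 < τ →
      ‖∫ l in (0:ℝ)..π, D l * (Real.cos (l / 2) * K (τ * Real.sin (l / 2)) : ℝ)‖ ≤ C / τ := by
  obtain ⟨hDc, D', M, hD'⟩ := hD
  have hderiv : ∀ x ∈ Set.Ioo 0 π, HasDerivAt D (deriv D x) x := fun x hx => by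
    rw [(hD' x hx).1.deriv]; exact (hD' x hx).1
  have hbd : ∀ x ∈ Set.Ioo 0 π, ‖deriv D x‖ ≤ M := fun x hx => by
    rw [(hD' x hx).1.deriv]; exact (hD' x hx).2
  have hM : 0 ≤ M := (norm_nonneg _).trans
    (hbd (π / 2) ⟨by linarith [Real.pi_pos], by linarith [Real.pi_pos]⟩)
  have hint : IntervalIntegrable (deriv D) volume 0 π := by
    rw [intervalIntegrable_iff_integrableOn_Ioo_of_le Real.pi_pos.le]
    exact Measure.integrableOn_of_bounded (by simp) (measurable_deriv D).aestronglyMeasurable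
      ((ae_restrict_iff' measurableSet_Ioo).2 (ae_of_all _ hbd))
  refine ⟨2 * (‖D π‖ + ‖D 0‖ + M * π), fun τ hτ => ?_⟩
  have hv : ∀ x, HasDerivAt (fun l : ℝ => ((2 / τ * Φ (τ * Real.sin (l / 2)) : ℝ) : ℂ))
      ((Real.cos (x / 2) * K (τ * Real.sin (x / 2)) : ℝ) : ℂ) x := by
    intro x
    have h1 := ((((hasDerivAt_id x).div_const 2).sin).const_mul τ)
    refine ((((hΦ (τ * Real.sin (x / 2))).comp x h1).const_mul (2 / τ)).ofReal_comp).congr_deriv ?_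
    congr 1
    simp only [id]
    field_simp
  have hvb : ∀ l : ℝ, ‖((2 / τ * Φ (τ * Real.sin (l / 2)) : ℝ) : ℂ)‖ ≤ 2 / τ := fun l => by
    rw [norm_real, norm_mul, Real.norm_of_nonneg (by positivity)]
    exact mul_le_of_le_one_right (by positivity) (hΦ1 _)
  have hIcc : Set.uIcc 0 π = Set.Icc 0 π := Set.uIcc_of_le Real.pi_pos.le
  rw [intervalIntegral.integral_mul_deriv_eq_deriv_mul_of_hasDerivAt (u := D) (u' := deriv D)
    (v := fun l : ℝ => ((2 / τ * Φ (τ * Real.sin (l / 2)) : ℝ) : ℂ))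
    (hIcc ▸ hDc) (fun x _ => (hv x).continuousAt.continuousWithinAt)
    (by rw [min_eq_left Real.pi_pos.le, max_eq_right Real.pi_pos.le]; exact hderiv)
    (fun x _ => hv x) hint
    ((by fun_prop : Continuous fun l : ℝ =>
      ((Real.cos (l / 2) * K (τ * Real.sin (l / 2)) : ℝ) : ℂ)).intervalIntegrable _ _)]
  have hprod : ∀ z : ℂ, ∀ l : ℝ, ‖z * ((2 / τ * Φ (τ * Real.sin (l / 2)) : ℝ) : ℂ)‖ ≤
      ‖z‖ * (2 / τ) := fun z l => by
    rw [norm_mul]; exact mul_le_mul_of_nonneg_left (hvb l) (norm_nonneg _)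
  have hrest : ‖∫ l in (0:ℝ)..π, deriv D l * ((2 / τ * Φ (τ * Real.sin (l / 2)) : ℝ) : ℂ)‖ ≤
      M * (2 / τ) * |π - 0| := by
    refine intervalIntegral.norm_integral_le_of_norm_le_const_ae ?_
    have hne : ∀ᵐ l : ℝ, l ≠ π := by simp [ae_iff]
    filter_upwards [hne] with l hl hl'
    rw [Set.uIoc_of_le Real.pi_pos.le] at hl'
    exact (hprod _ l).trans (mul_le_mul_of_nonneg_right
      (hbd l ⟨hl'.1, lt_of_le_of_ne hl'.2 hl⟩) (by positivity))
  rw [sub_zero, abs_of_pos Real.pi_pos] at hrest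
  calc _ ≤ _ := norm_sub_le _ _
    _ ≤ (‖D π‖ * (2 / τ) + ‖D 0‖ * (2 / τ)) + M * (2 / τ) * π :=
      add_le_add (norm_sub_le_of_le (hprod _ _) (hprod _ _)) hrest
    _ = _ := by ring

theorem tendsto_sqrt_mul_of_norm_le_div {f : ℝ → ℂ} {C : ℝ} (hf : ∀ τ : ℝ, 0 < τ → ‖f τ‖ ≤ C / τ) :
    Tendsto (fun τ : ℝ => (√τ : ℂ) * f τ) atTop (nhds 0) := by
  have h : Tendsto (fun τ : ℝ => C / √τ) atTop (nhds 0) :=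
    Real.tendsto_sqrt_atTop.const_div_atTop C
  refine squeeze_zero_norm' ((eventually_gt_atTop 0).mono fun τ hτ => ?_) h
  have hs : 0 < √τ := Real.sqrt_pos.2 hτ
  rw [norm_mul, norm_real, Real.norm_of_nonneg hs.le]
  calc √τ * ‖f τ‖ ≤ √τ * (C / τ) := by gcongr; exact hf τ hτ
    _ = √τ * (C / (√τ * √τ)) := by rw [Real.mul_self_sqrt hτ.le]
    _ = C / √τ := by field_simp

theorem norm_le_of_norm_deriv_deriv_le {N : ℝ → ℂ} (hN : ContDiff ℝ 2 N) {M a x : ℝ}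
    (hM : ∀ y ∈ Set.Icc 0 π, ‖deriv (deriv N) y‖ ≤ M) (ha : a ∈ Set.Icc 0 π)
    (hx : x ∈ Set.Icc 0 π) (h0 : N a = 0) (h1 : deriv N a = 0) :
    ‖deriv N x‖ ≤ M * |x - a| ∧ ‖N x‖ ≤ M * |x - a| ^ 2 := by
  have hM0 : 0 ≤ M := (norm_nonneg _).trans (hM a ha)
  have hN1 : Differentiable ℝ N := hN.differentiable (by norm_num)
  have hN2 : Differentiable ℝ (deriv N) := hN.differentiable_deriv_two
  have hsub : ∀ y ∈ Set.uIcc a x, y ∈ Set.Icc 0 π := fun y hy =>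
    Set.uIcc_subset_Icc ha hx hy
  have hd : ∀ y ∈ Set.Icc 0 π, ‖deriv N y‖ ≤ M * |y - a| := fun y hy => by
    have := (convex_Icc 0 π).norm_image_sub_le_of_norm_deriv_le (fun z _ => hN2 z) hM ha hy
    rwa [h1, sub_zero, Real.norm_eq_abs] at this
  refine ⟨hd x hx, ?_⟩
  have := (convex_uIcc a x).norm_image_sub_le_of_norm_deriv_le (f := N) (C := M * |x - a|)
    (fun z _ => hN1 z) (fun z hz => (hd z (hsub z hz)).trans
      (mul_le_mul_of_nonneg_left (Set.abs_sub_left_of_mem_uIcc hz) hM0))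
    Set.left_mem_uIcc Set.right_mem_uIcc
  rw [h0, sub_zero, Real.norm_eq_abs] at this
  linarith [this, (by ring : M * |x - a| ^ 2 = M * |x - a| * |x - a|)]

theorem hasBoundedDeriv_div_sin {N : ℝ → ℂ} (hN : ContDiff ℝ 2 N) (h0 : N 0 = 0)
    (h0' : deriv N 0 = 0) (hπ : N π = 0) (hπ' : deriv N π = 0) :
    HasBoundedDeriv fun x => N x / (Real.sin x : ℂ) := by
  have hpi := Real.pi_pos
  have hN1 : Differentiable ℝ N := hN.differentiable (by norm_num)
  have hc2 : Continuous (deriv (deriv N)) :=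
    ((contDiff_succ_iff_deriv (n := 1)).1 hN).2.2.continuous_deriv le_rfl
  obtain ⟨M, hM⟩ := isCompact_Icc.exists_bound_of_continuousOn (s := Set.Icc 0 π) hc2.continuousOn
  have hM0 : 0 ≤ M := (norm_nonneg _).trans (hM 0 ⟨le_rfl, hpi.le⟩)
  have hkey : ∀ x ∈ Set.Icc 0 π, ∃ m, 0 ≤ m ∧ m ≤ x ∧ m ≤ π - x ∧ (x ∈ Set.Ioo 0 π → 0 < m) ∧
      2 / π * m ≤ Real.sin x ∧ ‖deriv N x‖ ≤ M * m ∧ ‖N x‖ ≤ M * m ^ 2 := by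
    intro x hx
    rcases le_total x (π / 2) with h | h
    · have := norm_le_of_norm_deriv_deriv_le hN hM ⟨le_rfl, hpi.le⟩ hx h0 h0'
      rw [sub_zero, abs_of_nonneg hx.1] at this
      exact ⟨x, hx.1, le_rfl, by linarith, fun h => h.1, Real.mul_le_sin hx.1 h, this⟩
    · have := norm_le_of_norm_deriv_deriv_le hN hM ⟨hpi.le, le_rfl⟩ hx hπ hπ'
      rw [abs_sub_comm, abs_of_nonneg (sub_nonneg.2 hx.2)] at this
      refine ⟨π - x, by linarith [hx.2], by linarith, le_rfl, fun h => by linarith [h.2], ?_, this⟩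
      rw [← Real.sin_pi_sub]
      exact Real.mul_le_sin (by linarith [hx.2]) (by linarith)
  have hbound : ∀ x ∈ Set.Icc 0 π, ∃ m, 0 ≤ m ∧ m ≤ x ∧ m ≤ π - x ∧
      ‖N x / (Real.sin x : ℂ)‖ ≤ M * π / 2 * m := by
    intro x hx
    obtain ⟨m, hm0, hmx, hmx', hpos, hsin, -, hNx⟩ := hkey x hx
    refine ⟨m, hm0, hmx, hmx', ?_⟩
    rw [norm_div, norm_real, Real.norm_of_nonneg (Real.sin_nonneg_of_mem_Icc hx)]
    refine div_le_of_le_mul₀ (Real.sin_nonneg_of_mem_Icc hx) (by positivity) (hNx.trans ?_)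
    calc M * m ^ 2 = M * π / 2 * m * (2 / π * m) := by field_simp
      _ ≤ _ := by gcongr
  have hderiv : ∀ x ∈ Set.Ioo 0 π, HasDerivAt (fun x => N x / (Real.sin x : ℂ))
      ((deriv N x * Real.sin x - N x * Real.cos x) / (Real.sin x : ℂ) ^ 2) x := fun x hx =>
    (hN1 x).hasDerivAt.div (Real.hasDerivAt_sin x).ofReal_comp
      (ofReal_ne_zero.2 (Real.sin_pos_of_mem_Ioo hx).ne')
  refine ⟨fun x hx => ?_, _, M * π / 2 + M * π ^ 2 / 4, fun x hx => ⟨hderiv x hx, ?_⟩⟩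
  · rcases eq_or_lt_of_le hx.1 with rfl | hx0
    · have hz : N 0 / (Real.sin 0 : ℂ) = 0 := by simp
      rw [ContinuousWithinAt, hz]
      refine squeeze_zero_norm' (a := fun x => M * π / 2 * x)
        (eventually_mem_nhdsWithin.mono fun y hy => ?_) ?_
      · obtain ⟨m, -, h, -, h'⟩ := hbound y hy
        exact h'.trans (by gcongr)
      · have : Continuous fun x => M * π / 2 * x := by fun_prop
        simpa using (this.tendsto 0).mono_left nhdsWithin_le_nhds
    rcases eq_or_lt_of_le hx.2 with rfl | hxπ
    · have hz : N π / (Real.sin π : ℂ) = 0 := by simp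
      rw [ContinuousWithinAt, hz]
      refine squeeze_zero_norm' (a := fun x => M * π / 2 * (π - x))
        (eventually_mem_nhdsWithin.mono fun y hy => ?_) ?_
      · obtain ⟨m, -, -, h, h'⟩ := hbound y hy
        exact h'.trans (by gcongr)
      · have : Continuous fun x => M * π / 2 * (π - x) := by fun_prop
        simpa using (this.tendsto π).mono_left nhdsWithin_le_nhds
    exact (hderiv x ⟨hx0, hxπ⟩).continuousAt.continuousWithinAt
  · obtain ⟨m, hm0, -, -, hpos, hsin, hN'x, hNx⟩ := hkey x (Set.Ioo_subset_Icc_self hx)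
    have hm := hpos hx
    have hs := Real.sin_pos_of_mem_Ioo hx
    rw [norm_div, norm_pow, norm_real, Real.norm_of_nonneg hs.le, div_le_iff₀ (by positivity)]
    have hms : m ≤ π / 2 * Real.sin x := by
      calc m = π / 2 * (2 / π * m) := by field_simp
        _ ≤ _ := by gcongr
    calc _ ≤ ‖deriv N x * Real.sin x‖ + ‖N x * Real.cos x‖ := norm_sub_le _ _
      _ ≤ M * m * Real.sin x + M * m ^ 2 * 1 := by
        rw [norm_mul, norm_mul, norm_real, norm_real, Real.norm_of_nonneg hs.le]
        gcongr
        exact Real.abs_cos_le_one x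
      _ ≤ M * (π / 2 * Real.sin x) * Real.sin x + M * (π / 2 * Real.sin x) ^ 2 * 1 := by gcongr
      _ = _ := by ring

theorem tendsto_sqrt_mul_integral_cos_mul_cexp :
    Tendsto (fun τ : ℝ => (√τ : ℂ) *
        (∫ l in (0:ℝ)..π, (Real.cos ((π - l) / 4) : ℂ) * cexp (I * (τ * Real.sin (l / 2) : ℝ))) -
      √(2 * π) * cexp ((τ - π / 4 : ℝ) * I)) atTop (nhds 0) := by
  have h : Tendsto (fun τ : ℝ => 2 * √2 / √τ) atTop (nhds 0) :=
    Real.tendsto_sqrt_atTop.const_div_atTop _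
  refine squeeze_zero_norm' ((eventually_gt_atTop 0).mono fun τ hτ => ?_) h
  have hs : 0 < √τ := Real.sqrt_pos.2 hτ
  have hmain := integral_cos_mul_cexp_I_mul_sin (ρ := √τ)
  rw [Real.sq_sqrt hτ.le, ← ofReal_pow, Real.sq_sqrt hτ.le] at hmain
  have hc : (√(2 * π) : ℂ) * cexp ((τ - π / 4 : ℝ) * I) =
      2 * √2 * cexp (I * τ) * (√π * cexp (-(π / 4 : ℝ) * I) / 2) := by
    rw [Real.sqrt_mul (by norm_num), show ((τ - π / 4 : ℝ) : ℂ) * I = I * τ + -(π / 4 : ℝ) * I by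
      push_cast; ring, Complex.exp_add]
    push_cast
    ring
  rw [hmain, hc, ← mul_sub, norm_mul, norm_mul, mul_comm I, norm_exp_ofReal_mul_I, norm_mul,
    norm_real, Real.norm_of_nonneg (Real.sqrt_nonneg 2), norm_ofNat, mul_one]
  calc _ ≤ 2 * √2 * (1 / √τ) := by gcongr; exact norm_integral_cexp_neg_I_mul_sq_sub_le hs
    _ = _ := by ring

theorem tendsto_sqrt_mul_integral_cos_mul_cos_and_sin :
    Tendsto (fun τ : ℝ => √τ *
        (∫ l in (0:ℝ)..π, Real.cos ((π - l) / 4) * Real.cos (τ * Real.sin (l / 2))) -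
      √(2 * π) * Real.cos (τ - π / 4)) atTop (nhds 0) ∧
    Tendsto (fun τ : ℝ => √τ *
        (∫ l in (0:ℝ)..π, Real.cos ((π - l) / 4) * Real.sin (τ * Real.sin (l / 2))) -
      √(2 * π) * Real.sin (τ - π / 4)) atTop (nhds 0) := by
  have hsplit : ∀ τ : ℝ,
      (∫ l in (0:ℝ)..π, (Real.cos ((π - l) / 4) : ℂ) * cexp (I * (τ * Real.sin (l / 2) : ℝ))) =
      ((∫ l in (0:ℝ)..π, Real.cos ((π - l) / 4) * Real.cos (τ * Real.sin (l / 2)) : ℝ) : ℂ) +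
      ((∫ l in (0:ℝ)..π, Real.cos ((π - l) / 4) * Real.sin (τ * Real.sin (l / 2)) : ℝ) : ℂ) * I := by
    intro τ
    rw [← intervalIntegral.integral_ofReal, ← intervalIntegral.integral_ofReal,
      ← intervalIntegral.integral_mul_const, ← intervalIntegral.integral_add]
    · refine intervalIntegral.integral_congr fun l _ => ?_
      simp only [mul_comm I, Complex.exp_mul_I]
      push_cast
      ring
    · exact (by fun_prop : Continuous fun l : ℝ =>
        ((Real.cos ((π - l) / 4) * Real.cos (τ * Real.sin (l / 2)) : ℝ) : ℂ)).intervalIntegrable _ _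
    · exact (by fun_prop : Continuous fun l : ℝ =>
        ((Real.cos ((π - l) / 4) * Real.sin (τ * Real.sin (l / 2)) : ℝ) : ℂ) *
          I).intervalIntegrable _ _
  have h := tendsto_sqrt_mul_integral_cos_mul_cexp
  simp only [hsplit] at h
  constructor
  · refine ((continuous_re.tendsto 0).comp h).congr fun τ => ?_
    simp only [Function.comp, sub_re, add_re, ofReal_re, exp_ofReal_mul_I_re,
      mul_re, I_re, I_im, ofReal_im]
    ring
  · refine ((continuous_im.tendsto 0).comp h).congr fun τ => ?_
    simp only [Function.comp, sub_im, add_im, ofReal_im, exp_ofReal_mul_I_im,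
      mul_im, I_re, I_im, ofReal_re]
    ring

theorem two_mul_sin_half_div_sin_mul_cos_half {l : ℝ} (hl : l ∈ Set.Ioo 0 π) :
    (2 * (Real.sin (l / 2) : ℂ)) / (Real.sin l : ℂ) * Real.cos (l / 2) = 1 := by
  have h : Real.sin l = 2 * Real.sin (l / 2) * Real.cos (l / 2) := by
    rw [← Real.sin_two_mul]; ring_nf
  have hs : (Real.sin l : ℂ) ≠ 0 := ofReal_ne_zero.2 (Real.sin_pos_of_mem_Ioo hl).ne'
  rw [div_mul_eq_mul_div, div_eq_one_iff_eq hs, h]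
  push_cast
  ring

theorem hasBoundedDeriv_cos_half : HasBoundedDeriv fun l => (Real.cos (l / 2) : ℂ) :=
  hasBoundedDeriv_of_continuousOn
    (fun x _ => (((hasDerivAt_id x).div_const 2).cos).ofReal_comp)
    (by simp only [id]; fun_prop)

/-- Stationary phase at the simple critical point `π` of `sin (l / 2)`, relative to the amplitude
`cos ((π - l) / 4)`. -/
theorem tendsto_sqrt_mul_integral_sub {Φ K R : ℝ → ℝ} (hΦ : ∀ u, HasDerivAt Φ (K u) u)
    (hK : Continuous K) (hΦ1 : ∀ u, |Φ u| ≤ 1)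
    (hR : Tendsto (fun τ : ℝ => √τ *
      (∫ l in (0:ℝ)..π, Real.cos ((π - l) / 4) * K (τ * Real.sin (l / 2))) - R τ) atTop (nhds 0))
    {G : ℝ → ℂ} (hG : ContDiff ℝ 2 G) (hG' : deriv G π = 0) :
    Tendsto (fun τ : ℝ => (√τ : ℂ) * (∫ l in (0:ℝ)..π, G l * (K (τ * Real.sin (l / 2)) : ℂ)) -
      G π * R τ) atTop (nhds 0) := by
  have hcast : ∀ {f : ℝ → ℝ}, ContDiff ℝ 2 f → ContDiff ℝ 2 fun l => (f l : ℂ) :=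
    fun hf => ofRealCLM.contDiff.comp hf
  set β : ℂ := G 0 - G π * (Real.cos (π / 4) : ℂ) with hβ
  set F : ℝ → ℂ := fun l => G l - G π * (Real.cos ((π - l) / 4) : ℂ) -
    β * ((Real.cos (l / 2) ^ 2 : ℝ) : ℂ) with hF
  have hFd : ContDiff ℝ 2 F := by
    refine (hG.sub (contDiff_const.mul (hcast ?_))).sub (contDiff_const.mul (hcast ?_)) <;> fun_prop
  have hF0 : F 0 = 0 := by
    simp only [hF, hβ, sub_zero, zero_div, Real.cos_zero, one_pow, ofReal_one, mul_one]
    ring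
  have hFπ : F π = 0 := by simp [hF]
  have hF'π : HasDerivAt F 0 π := by
    have h1 := (((hasDerivAt_id π).const_sub π).div_const 4).cos.ofReal_comp.const_mul (G π)
    have h2 := ((((hasDerivAt_id π).div_const 2).cos).pow 2).ofReal_comp.const_mul β
    have h3 := (hG.differentiable (by norm_num) π).hasDerivAt
    rw [hG'] at h3
    refine ((h3.sub h1).sub h2).congr_deriv ?_
    simp
  have hN : ContDiff ℝ 2 fun l => F l * (Real.sin (l / 2) : ℂ) :=
    hFd.mul (hcast (by fun_prop))
  have hN' : ∀ x d : _, HasDerivAt F d x → deriv (fun l => F l * (Real.sin (l / 2) : ℂ)) x =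
      d * Real.sin (x / 2) + F x * (Real.cos (x / 2) * (1 / 2) : ℝ) := fun x d hd =>
    (hd.mul (((hasDerivAt_id x).div_const 2).sin).ofReal_comp).deriv
  have hD := ((hasBoundedDeriv_div_sin hN (by simp) (by
      rw [hN' 0 _ (hFd.differentiable (by norm_num) 0).hasDerivAt, hF0]; simp)
    (by simp [hFπ]) (by rw [hN' π _ hF'π, hFπ]; simp)).const_mul 2).add
    (hasBoundedDeriv_cos_half.const_mul β)
  set D : ℝ → ℂ := fun x => 2 * (F x * (Real.sin (x / 2) : ℂ) / (Real.sin x : ℂ)) +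
    β * (Real.cos (x / 2) : ℂ) with hDdef
  have hid : ∀ l ∈ Set.Icc 0 π, G l = G π * (Real.cos ((π - l) / 4) : ℂ) +
      D l * (Real.cos (l / 2) : ℂ) := by
    intro l hl
    have hFD : F l = 2 * (F l * (Real.sin (l / 2) : ℂ) / (Real.sin l : ℂ)) *
        (Real.cos (l / 2) : ℂ) := by
      rcases eq_or_lt_of_le hl.1 with rfl | h0
      · simp [hF0]
      rcases eq_or_lt_of_le hl.2 with rfl | h1
      · simp [hFπ]
      linear_combination (-F l) * two_mul_sin_half_div_sin_mul_cos_half ⟨h0, h1⟩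
    have hG : G l = F l + G π * (Real.cos ((π - l) / 4) : ℂ) +
        β * ((Real.cos (l / 2) ^ 2 : ℝ) : ℂ) := by simp only [hF]; ring
    rw [hG, hDdef]
    push_cast at hFD ⊢
    linear_combination hFD
  obtain ⟨C, hC⟩ := hD.exists_norm_integral_le hΦ hK hΦ1
  have hlim := ((continuous_ofReal.tendsto 0).comp hR).const_mul (G π) |>.add
    (tendsto_sqrt_mul_of_norm_le_div hC)
  rw [ofReal_zero, mul_zero, zero_add] at hlim
  refine hlim.congr fun τ => ?_
  have hint : (∫ l in (0:ℝ)..π, G l * (K (τ * Real.sin (l / 2)) : ℂ)) =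
      G π * ((∫ l in (0:ℝ)..π, Real.cos ((π - l) / 4) * K (τ * Real.sin (l / 2)) : ℝ) : ℂ) +
      ∫ l in (0:ℝ)..π, D l * (Real.cos (l / 2) * K (τ * Real.sin (l / 2)) : ℝ) := by
    rw [← intervalIntegral.integral_ofReal, ← intervalIntegral.integral_const_mul,
      ← intervalIntegral.integral_add]
    · refine intervalIntegral.integral_congr fun l hl => ?_
      rw [Set.uIcc_of_le Real.pi_pos.le] at hl
      rw [hid l hl]
      push_cast
      ring
    · exact (by fun_prop : Continuous fun l : ℝ => G π *
        ((Real.cos ((π - l) / 4) * K (τ * Real.sin (l / 2)) : ℝ) : ℂ)).intervalIntegrable _ _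
    · refine ContinuousOn.intervalIntegrable ?_
      rw [Set.uIcc_of_le Real.pi_pos.le]
      exact hD.1.mul (by fun_prop)
  rw [hint]
  simp only [Function.comp]
  push_cast
  ring

theorem hasBoundedDeriv_tan_quarter : HasBoundedDeriv fun l => (Real.tan (l / 4) : ℂ) := by
  have hcos : ∀ x ∈ Set.Icc 0 π, Real.cos (x / 4) ≠ 0 := fun x hx =>
    (Real.cos_pos_of_mem_Ioo ⟨by linarith [hx.1, Real.pi_pos], by linarith [hx.2, Real.pi_pos]⟩).ne'
  refine hasBoundedDeriv_of_continuousOn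
    (D' := fun x => ((1 / Real.cos (x / 4) ^ 2 * (1 / 4) : ℝ) : ℂ)) (fun x hx => ?_) ?_
  · exact ((Real.hasDerivAt_tan (hcos x hx)).comp x ((hasDerivAt_id x).div_const 4)).ofReal_comp
  · refine continuous_ofReal.comp_continuousOn ?_
    exact (ContinuousOn.div (by fun_prop) (by fun_prop) fun x hx => pow_ne_zero 2 (hcos x hx)).mul
      continuousOn_const

theorem integral_cos_half_mul_sinc (τ : ℝ) :
    ∫ l in (0:ℝ)..π, Real.cos (l / 2) * (τ * Real.sinc (τ * Real.sin (l / 2))) =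
      2 * ∫ u in (0:ℝ)..τ, Real.sinc u := by
  have h := intervalIntegral.integral_comp_mul_deriv (a := 0) (b := π)
    (f := fun l => τ * Real.sin (l / 2)) (f' := fun l => τ * (Real.cos (l / 2) * (1 / 2)))
    (g := Real.sinc) (fun x _ => (((hasDerivAt_id x).div_const 2).sin).const_mul τ)
    (by fun_prop) Real.continuous_sinc
  simp only [zero_div, Real.sin_zero, mul_zero, Real.sin_pi_div_two, mul_one] at h
  rw [← h, ← intervalIntegral.integral_const_mul]
  refine intervalIntegral.integral_congr fun l _ => ?_
  simp only [Function.comp]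
  ring

theorem mul_sinc_mul {τ s : ℝ} (hτ : τ ≠ 0) (hs : s ≠ 0) :
    τ * Real.sinc (τ * s) = Real.sin (τ * s) / s := by
  rw [Real.sinc_of_ne_zero (mul_ne_zero hτ hs)]
  field_simp

theorem tan_quarter_mul_sin_half {l : ℝ} (hl : l ∈ Set.Icc 0 π) :
    Real.tan (l / 4) * Real.sin (l / 2) = 1 - Real.cos (l / 2) := by
  have hcos : Real.cos (l / 4) ≠ 0 :=
    (Real.cos_pos_of_mem_Ioo ⟨by linarith [hl.1, Real.pi_pos], by linarith [hl.2, Real.pi_pos]⟩).ne'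
  rw [show l / 2 = 2 * (l / 4) by ring, Real.sin_two_mul, Real.cos_two_mul, Real.cos_sq',
    Real.tan_eq_sin_div_cos]
  field_simp
  ring

theorem hasDerivAt_neg_cos (u : ℝ) : HasDerivAt (fun u => -Real.cos u) (Real.sin u) u :=
  (Real.hasDerivAt_cos u).neg.congr_deriv (neg_neg _)

/-- Both endpoints contribute: `0` through the Dirichlet integral, `π` by stationary phase. -/
theorem tendsto_sqrt_mul_integral_sinc_sub {H : ℝ → ℂ} (hH : ContDiff ℝ 2 H)
    (hH0 : deriv H 0 = 0) (hHπ : deriv H π = 0) :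
    Tendsto (fun τ : ℝ => (√τ : ℂ) *
        ((∫ l in (0:ℝ)..π, H l * (τ * Real.sinc (τ * Real.sin (l / 2)) : ℝ)) - π * H 0) -
      H π * (√(2 * π) * Real.sin (τ - π / 4) : ℝ)) atTop (nhds 0) := by
  have hcast : ∀ {f : ℝ → ℝ}, ContDiff ℝ 2 f → ContDiff ℝ 2 fun l => (f l : ℂ) :=
    fun hf => ofRealCLM.contDiff.comp hf
  set N : ℝ → ℂ := fun l => H l - H 0 * ((Real.cos (l / 2) ^ 2 : ℝ) : ℂ) -
    H π * ((Real.sin (l / 2) ^ 2 : ℝ) : ℂ) with hN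
  have hNd : ContDiff ℝ 2 N := by
    refine (hH.sub (contDiff_const.mul (hcast ?_))).sub (contDiff_const.mul (hcast ?_)) <;> fun_prop
  have hN' : ∀ x, deriv H x = 0 → Real.sin (x / 2) * Real.cos (x / 2) = 0 → deriv N x = 0 := by
    intro x hx hsc
    have h1 := ((((hasDerivAt_id x).div_const 2).cos).pow 2).ofReal_comp.const_mul (H 0)
    have h2 := ((((hasDerivAt_id x).div_const 2).sin).pow 2).ofReal_comp.const_mul (H π)
    have h3 := (hH.differentiable (by norm_num) x).hasDerivAt
    have h4 : HasDerivAt N _ x := (h3.sub h1).sub h2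
    rw [h4.deriv, hx]
    have hsc' : (Real.sin (x / 2) : ℂ) * Real.cos (x / 2) = 0 := by exact_mod_cast hsc
    simp only [id]
    push_cast at hsc' ⊢
    linear_combination (H 0 - H π) * hsc'
  have hN0 : N 0 = 0 := by simp [hN]
  have hNπ : N π = 0 := by simp [hN]
  have hE := ((hasBoundedDeriv_div_sin hNd hN0 (hN' 0 hH0 (by simp)) hNπ
    (hN' π hHπ (by simp))).const_mul 2).add (hasBoundedDeriv_tan_quarter.const_mul (-H 0))
  set E : ℝ → ℂ := fun x => 2 * (N x / (Real.sin x : ℂ)) + -H 0 * (Real.tan (x / 4) : ℂ) with hEdef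
  have hid : ∀ τ : ℝ, 0 < τ → ∀ l ∈ Set.Icc 0 π,
      H l * (τ * Real.sinc (τ * Real.sin (l / 2)) : ℝ) =
        H 0 * (Real.cos (l / 2) * (τ * Real.sinc (τ * Real.sin (l / 2))) : ℝ) +
        H π * ((Real.sin (l / 2) : ℂ) * (Real.sin (τ * Real.sin (l / 2)) : ℂ)) +
        E l * (Real.cos (l / 2) * Real.sin (τ * Real.sin (l / 2)) : ℝ) := by
    intro τ hτ l hl
    rcases eq_or_lt_of_le hl.1 with rfl | h0
    · simp
    have hs : Real.sin (l / 2) ≠ 0 :=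
      (Real.sin_pos_of_mem_Ioo ⟨by linarith, by linarith [hl.2]⟩).ne'
    have hs' : (Real.sin (l / 2) : ℂ) ≠ 0 := ofReal_ne_zero.2 hs
    have hNs : 2 * (N l / (Real.sin l : ℂ)) * (Real.cos (l / 2) : ℂ) * (Real.sin (l / 2) : ℂ) =
        N l := by
      rcases eq_or_lt_of_le hl.2 with rfl | h1
      · simp [hNπ]
      linear_combination N l * two_mul_sin_half_div_sin_mul_cos_half ⟨h0, h1⟩
    have htan : (Real.tan (l / 4) : ℂ) * Real.sin (l / 2) = 1 - Real.cos (l / 2) := by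
      exact_mod_cast tan_quarter_mul_sin_half hl
    have hNl : H l = N l + H 0 * (Real.cos (l / 2) : ℂ) ^ 2 + H π * (Real.sin (l / 2) : ℂ) ^ 2 := by
      simp only [hN]
      push_cast
      ring
    rw [mul_sinc_mul hτ.ne' hs, hNl, hEdef]
    simp only [ofReal_mul, ofReal_div]
    generalize (Real.sin (τ * Real.sin (l / 2)) : ℂ) = z
    field_simp
    linear_combination (-z) * hNs + z * H 0 * (Real.cos (l / 2) : ℂ) * htan
  obtain ⟨C, hC⟩ := hE.exists_norm_integral_le (Φ := fun u => -Real.cos u)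
    hasDerivAt_neg_cos Real.continuous_sin
    (fun u => by rw [abs_neg]; exact Real.abs_cos_le_one u)
  have hJ : ∀ τ : ℝ, 0 < τ → ‖((∫ l in (0:ℝ)..π,
      Real.cos (l / 2) * (τ * Real.sinc (τ * Real.sin (l / 2))) : ℝ) : ℂ) - π‖ ≤ 4 / τ := by
    intro τ hτ
    rw [← ofReal_sub, norm_real, Real.norm_eq_abs, integral_cos_half_mul_sinc,
      show ∀ x : ℝ, 2 * x - π = 2 * (x - π / 2) from fun x => by ring, abs_mul, abs_two]
    calc _ ≤ 2 * (2 / τ) := by gcongr; exact abs_integral_sinc_sub_pi_div_two_le hτ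
      _ = _ := by ring
  have hsin := tendsto_sqrt_mul_integral_sub (Φ := fun u => -Real.cos u) (K := Real.sin)
    hasDerivAt_neg_cos Real.continuous_sin
    (fun u => by rw [abs_neg]; exact Real.abs_cos_le_one u)
    tendsto_sqrt_mul_integral_cos_mul_cos_and_sin.2
    (G := fun l => (Real.sin (l / 2) : ℂ)) (hcast (by fun_prop)) (by
      have h : HasDerivAt (fun l => (Real.sin (l / 2) : ℂ)) _ π :=
        (((hasDerivAt_id π).div_const 2).sin).ofReal_comp
      rw [h.deriv]
      simp)
  have hlim := (((tendsto_sqrt_mul_of_norm_le_div hJ).const_mul (H 0)).add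
    (hsin.const_mul (H π))).add (tendsto_sqrt_mul_of_norm_le_div hC)
  simp only [mul_zero, add_zero] at hlim
  refine hlim.congr' ((eventually_gt_atTop 0).mono fun τ hτ => ?_)
  have hint : (∫ l in (0:ℝ)..π, H l * (τ * Real.sinc (τ * Real.sin (l / 2)) : ℝ)) =
      H 0 * ((∫ l in (0:ℝ)..π,
        Real.cos (l / 2) * (τ * Real.sinc (τ * Real.sin (l / 2))) : ℝ) : ℂ) +
      H π * (∫ l in (0:ℝ)..π, (Real.sin (l / 2) : ℂ) * (Real.sin (τ * Real.sin (l / 2)) : ℂ)) +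
      ∫ l in (0:ℝ)..π, E l * (Real.cos (l / 2) * Real.sin (τ * Real.sin (l / 2)) : ℝ) := by
    have h1 : IntervalIntegrable (fun l : ℝ => H 0 *
        ((Real.cos (l / 2) * (τ * Real.sinc (τ * Real.sin (l / 2))) : ℝ) : ℂ)) volume 0 π := by
      have := Real.continuous_sinc
      exact (by fun_prop : Continuous _).intervalIntegrable _ _
    have h2 : IntervalIntegrable (fun l : ℝ => H π *
        ((Real.sin (l / 2) : ℂ) * (Real.sin (τ * Real.sin (l / 2)) : ℂ))) volume 0 π :=
      (by fun_prop : Continuous _).intervalIntegrable _ _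
    rw [← intervalIntegral.integral_ofReal, ← intervalIntegral.integral_const_mul,
      ← intervalIntegral.integral_const_mul, ← intervalIntegral.integral_add h1 h2,
      ← intervalIntegral.integral_add (h1.add h2)]
    · refine intervalIntegral.integral_congr fun l hl => ?_
      rw [Set.uIcc_of_le Real.pi_pos.le] at hl
      exact hid τ hτ l hl
    · refine ContinuousOn.intervalIntegrable ?_
      rw [Set.uIcc_of_le Real.pi_pos.le]
      exact hE.1.mul (by fun_prop)
  simp only [hint, Real.sin_pi_div_two, ofReal_one]
  push_cast
  ring

theorem integral_mul_fold {g w : ℝ → ℂ} (hg : Continuous g) (hw : Continuous w)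
    (hsymm : ∀ l, w (2 * π - l) = w l) :
    ∫ l in (0:ℝ)..(2 * π), g l * w l = ∫ l in (0:ℝ)..π, (g l + g (2 * π - l)) * w l := by
  have hgw : Continuous fun l => g l * w l := hg.mul hw
  have h := intervalIntegral.integral_comp_sub_left (a := 0) (b := π) (fun l => g l * w l) (2 * π)
  rw [sub_zero, show 2 * π - π = π by ring] at h
  have hgw' : Continuous fun l => g (2 * π - l) * w (2 * π - l) := by fun_prop
  rw [← intervalIntegral.integral_add_adjacent_intervals (hgw.intervalIntegrable 0 π)
    (hgw.intervalIntegrable π _), ← h, ← intervalIntegral.integral_add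
    (hgw.intervalIntegrable _ _) (hgw'.intervalIntegrable _ _)]
  exact intervalIntegral.integral_congr fun l _ => by simp only [hsymm]; ring

theorem deriv_fold {g : ℝ → ℂ} (hg : Differentiable ℝ g) (x : ℝ) :
    deriv (fun l => g l + g (2 * π - l)) x = deriv g x - deriv g (2 * π - x) := by
  have hg' : DifferentiableAt ℝ (fun l => g (2 * π - l)) x := by fun_prop
  rw [deriv_fun_add (hg x) hg', deriv_comp_const_sub, ← sub_eq_add_neg]

theorem deriv_fold_pi {g : ℝ → ℂ} (hg : Differentiable ℝ g) :
    deriv (fun l => g l + g (2 * π - l)) π = 0 := by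
  rw [deriv_fold hg, show 2 * π - π = π by ring, sub_self]

theorem deriv_fold_zero {g : ℝ → ℂ} (hg : Differentiable ℝ g)
    (hper : Function.Periodic g (2 * π)) :
    deriv (fun l => g l + g (2 * π - l)) 0 = 0 := by
  have h := deriv_comp_add_const (f := g) (2 * π) 0
  rw [funext hper, zero_add] at h
  rw [deriv_fold hg, sub_zero, h, sub_self]

theorem periodic_cexp_neg_I_mul_int (k : ℤ) :
    Function.Periodic (fun l : ℝ => cexp (-I * k * l)) (2 * π) := fun l => by
  have h := exp_int_mul_two_pi_mul_I (-k)
  push_cast at h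
  simp only
  rw [show -I * k * ((l + 2 * π : ℝ) : ℂ) = -I * k * l + -k * (2 * π * I) by push_cast; ring,
    Complex.exp_add, h, mul_one]

theorem cexp_neg_I_mul_int_mul_pi (k : ℤ) : cexp (-I * k * π) = (-1) ^ k := by
  rw [show -I * k * (π : ℂ) = k * -(π * I) by ring, exp_int_mul, Complex.exp_neg, exp_pi_mul_I]
  norm_num

/-- For `ω₀ = 0`, smooth Fourier data (`Cⁿ`, `n ≥ 6`) and fixed `k`,
the solution converges to `P(0)/(2ω₁)` with explicit `1/√t` oscillatory correction. -/
theorem harmonic_chain_time_asymptotics_zero (ω₁ : ℝ) (hω₁ : 0 < ω₁)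
    (ω : ℝ → ℝ) (hω : ∀ l : ℝ, ω l = 2 * ω₁ * Real.sin (l / 2))
    (n : ℕ) (hn : 6 ≤ n)
    (Q P : ℝ → ℂ) (hQ : ContDiff ℝ n Q) (hP : ContDiff ℝ n P)
    (hQper : Function.Periodic Q (2 * π)) (hPper : Function.Periodic P (2 * π))
    (q : ℤ → ℝ → ℂ)
    (hq : ∀ (k : ℤ) (t : ℝ), q k t =
      (1 / (2 * (π : ℂ))) * ∫ l in (0:ℝ)..(2 * π),
        (Q l * (Real.cos (t * ω l) : ℂ) +
            P l * (if ω l = 0 then (t : ℂ) else ((Real.sin (t * ω l) / ω l : ℝ) : ℂ))) *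
          Complex.exp (-Complex.I * (k : ℂ) * (l : ℂ)))
    (C S : ℂ) (hC : C = Q π / (Real.sqrt (π * ω₁) : ℂ))
    (hS : S = P π / ((2 * ω₁ * Real.sqrt (π * ω₁) : ℝ) : ℂ)) :
    ∀ k : ℤ,
      Tendsto (fun t : ℝ =>
          (Real.sqrt t : ℂ) * (q k t - P 0 / (2 * (ω₁ : ℂ))) -
            (-1 : ℂ) ^ k *
              (C * (Real.cos (2 * ω₁ * t - π / 4) : ℂ) +
                S * (Real.sin (2 * ω₁ * t - π / 4) : ℂ)))
        atTop (nhds 0) := by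
  intro k
  have hp := Real.pi_pos
  have hE : ContDiff ℝ 2 fun l : ℝ => cexp (-I * k * l) :=
    (contDiff_const.mul ofRealCLM.contDiff).cexp
  have hEper := periodic_cexp_neg_I_mul_int k
  have h2n : ((2 : ℕ) : WithTop ℕ∞) ≤ n := by exact_mod_cast (by omega : 2 ≤ n)
  set g : ℝ → ℂ := fun l => cexp (-I * k * l) * Q l with hg
  set h : ℝ → ℂ := fun l => cexp (-I * k * l) * P l with hh
  have hgd : ContDiff ℝ 2 g := hE.mul (hQ.of_le h2n)
  have hhd : ContDiff ℝ 2 h := hE.mul (hP.of_le h2n)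
  have hgd' := hgd.differentiable (by norm_num)
  have hhd' := hhd.differentiable (by norm_num)
  have hhper : Function.Periodic h (2 * π) := hEper.mul hPper
  have hfold : ∀ {f : ℝ → ℂ}, ContDiff ℝ 2 f → ContDiff ℝ 2 fun l => f l + f (2 * π - l) :=
    fun hf => hf.add (hf.comp (contDiff_const.sub contDiff_id))
  have hA := tendsto_sqrt_mul_integral_sub (Φ := Real.sin) Real.hasDerivAt_sin Real.continuous_cos
    Real.abs_sin_le_one tendsto_sqrt_mul_integral_cos_mul_cos_and_sin.1 (hfold hgd)
    (deriv_fold_pi hgd')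
  have hB := tendsto_sqrt_mul_integral_sinc_sub (hfold hhd) (deriv_fold_zero hhd' hhper)
    (deriv_fold_pi hhd')
  have hqk : ∀ t : ℝ, q k t = 1 / (2 * (π : ℂ)) *
      ((∫ l in (0:ℝ)..π, (g l + g (2 * π - l)) *
          (Real.cos (2 * ω₁ * t * Real.sin (l / 2)) : ℂ)) +
        1 / (2 * ω₁) * ∫ l in (0:ℝ)..π, (h l + h (2 * π - l)) *
          (2 * ω₁ * t * Real.sinc (2 * ω₁ * t * Real.sin (l / 2)) : ℝ)) := by
    intro t
    have hsc := Real.continuous_sinc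
    have hsymm : ∀ l, Real.sin ((2 * π - l) / 2) = Real.sin (l / 2) := fun l => by
      rw [← Real.sin_pi_sub (l / 2)]; ring_nf
    have hw1 : Continuous fun l : ℝ => (Real.cos (2 * ω₁ * t * Real.sin (l / 2)) : ℂ) := by
      fun_prop
    have hw2 : Continuous fun l : ℝ =>
        ((2 * ω₁ * t * Real.sinc (2 * ω₁ * t * Real.sin (l / 2)) : ℝ) : ℂ) := by fun_prop
    have hgw : Continuous fun l => g l * (Real.cos (2 * ω₁ * t * Real.sin (l / 2)) : ℂ) :=
      hgd.continuous.mul hw1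
    have hhw : Continuous fun l => 1 / (2 * (ω₁ : ℂ)) *
        (h l * (2 * ω₁ * t * Real.sinc (2 * ω₁ * t * Real.sin (l / 2)) : ℝ)) :=
      continuous_const.mul (hhd.continuous.mul hw2)
    rw [hq, ← integral_mul_fold hgd.continuous hw1 fun l => by rw [hsymm],
      ← integral_mul_fold hhd.continuous hw2 fun l => by rw [hsymm],
      ← intervalIntegral.integral_const_mul (1 / (2 * (ω₁ : ℂ))),
      ← intervalIntegral.integral_add (hgw.intervalIntegrable _ _) (hhw.intervalIntegrable _ _)]
    congr 1
    refine intervalIntegral.integral_congr fun l _ => ?_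
    have harg : t * ω l = 2 * ω₁ * t * Real.sin (l / 2) := by rw [hω]; ring
    have hif : (if ω l = 0 then (t : ℂ) else ((Real.sin (t * ω l) / ω l : ℝ) : ℂ)) =
        ((t * Real.sinc (t * ω l) : ℝ) : ℂ) := by
      split_ifs with h0
      · simp [h0]
      · rcases eq_or_ne t 0 with rfl | ht
        · simp
        · rw [mul_sinc_mul ht h0]
    have hω' : (ω₁ : ℂ) ≠ 0 := ofReal_ne_zero.2 hω₁.ne'
    rw [hif, harg]
    simp only [hg, hh]
    push_cast
    field_simp
  have hG : g π + g (2 * π - π) = 2 * (-1) ^ k * Q π := by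
    rw [show 2 * π - π = π by ring]
    simp only [hg, cexp_neg_I_mul_int_mul_pi]
    ring
  have hH : h π + h (2 * π - π) = 2 * (-1) ^ k * P π := by
    rw [show 2 * π - π = π by ring]
    simp only [hh, cexp_neg_I_mul_int_mul_pi]
    ring
  have hH0 : h 0 + h (2 * π - 0) = 2 * P 0 := by
    rw [sub_zero, hhper.eq]
    simp [hh]
    ring
  have hconst : √(π * ω₁) * √(2 * π) = π * √(2 * ω₁) := by
    rw [← Real.sqrt_mul (by positivity), show π * ω₁ * (2 * π) = π ^ 2 * (2 * ω₁) by ring,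
      Real.sqrt_mul (by positivity), Real.sqrt_sq hp.le]
  have hlim := ((hA.add (hB.const_mul (1 / (2 * ω₁ : ℂ)))).comp
    (tendsto_id.const_mul_atTop (by positivity : 0 < 2 * ω₁))).const_mul
    (1 / (2 * π * √(2 * ω₁) : ℂ))
  rw [mul_zero, add_zero, mul_zero] at hlim
  refine hlim.congr fun t => ?_
  have hconst' : (√(π * ω₁) : ℂ) * √(2 * π) = π * √(2 * ω₁) := by exact_mod_cast hconst
  have ha : (√(2 * ω₁) : ℂ) ≠ 0 := ofReal_ne_zero.2 (Real.sqrt_pos.2 (by positivity)).ne'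
  have hd : (√(π * ω₁) : ℂ) ≠ 0 := ofReal_ne_zero.2 (Real.sqrt_pos.2 (by positivity)).ne'
  have hπ0 : (π : ℂ) ≠ 0 := ofReal_ne_zero.2 hp.ne'
  have hω0 : (ω₁ : ℂ) ≠ 0 := ofReal_ne_zero.2 hω₁.ne'
  have hsqrt : (√(2 * ω₁ * t) : ℂ) = √(2 * ω₁) * √t := by
    rw [Real.sqrt_mul (by positivity), ofReal_mul]
  have hb : (√(2 * π) : ℂ) = π * √(2 * ω₁) / √(π * ω₁) := by
    rw [eq_div_iff hd, mul_comm, hconst']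
  simp only [Function.comp, id, hqk, hG, hH, hH0, hC, hS, hsqrt, ofReal_mul (√(2 * π)), hb]
  generalize (∫ l in (0:ℝ)..π, (g l + g (2 * π - l)) *
          (Real.cos (2 * ω₁ * t * Real.sin (l / 2)) : ℂ)) = X
  generalize (∫ l in (0:ℝ)..π, (h l + h (2 * π - l)) *
          (2 * ω₁ * t * Real.sinc (2 * ω₁ * t * Real.sin (l / 2)) : ℝ)) = Y
  rw [ofReal_mul, ofReal_mul, ofReal_ofNat]
  generalize (Real.cos (2 * ω₁ * t - π / 4) : ℂ) = c
  generalize (Real.sin (2 * ω₁ * t - π / 4) : ℂ) = s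
  field_simp
  ring
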